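/- Let B = ℂ[x, y, z, t]/(x + x²y + z² + t³), the coordinate ring of the Russell cubic threefold. Then B admits no positive ℤ-grading over ℂ; that is, there is no ℤ-grading B = ⊕_{i∈ℤ} B_i with B_i = 0 for all i < 0 and B_0 = ℂ. -/

import Mathlib

set_option synthInstance.maxHeartbeats 1000000
set_option maxHeartbeats 1000000

open MvPolynomial

/-- The coordinate ring `B = ℂ[x, y, z, t]/(x + x²y + z² + t³)` of the Russell cubic
threefold, with `x = X 0`, `y = X 1`, `z = X 2`, `t = X 3`. -/
abbrev RussellCubicRing : Type :=
  MvPolynomial (Fin 4) ℂ ⧸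
    Ideal.span {(X 0 : MvPolynomial (Fin 4) ℂ) + X 0 ^ 2 * X 1 + X 2 ^ 2 + X 3 ^ 3}

/-- `B` admits a positive ℤ-grading over `k`: a ℤ-grading `B = ⊕ B_i` by `k`-submodules
with `B_i = 0` for `i < 0` and `B_0 = k`. -/
def HasPositiveZGrading (k B : Type*) [CommRing k] [CommRing B] [Algebra k B] : Prop :=
  ∃ 𝒜 : ℤ → Submodule k B, Nonempty (GradedAlgebra 𝒜) ∧
    (∀ i : ℤ, i < 0 → 𝒜 i = ⊥) ∧ 𝒜 0 = 1

section Univariate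

open Polynomial

theorem natDegree_eq_zero_left_of_mul {R : Type*} [Semiring R] [NoZeroDivisors R] {p q : R[X]}
    (h0 : p * q ≠ 0) (h : (p * q).natDegree = 0) : p.natDegree = 0 := by
  rw [natDegree_mul (left_ne_zero_of_mul h0) (right_ne_zero_of_mul h0)] at h
  lia

theorem natDegree_eq_zero_right_of_mul {R : Type*} [Semiring R] [NoZeroDivisors R] {p q : R[X]}
    (h0 : p * q ≠ 0) (h : (p * q).natDegree = 0) : q.natDegree = 0 := by
  rw [natDegree_mul (left_ne_zero_of_mul h0) (right_ne_zero_of_mul h0)] at h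
  lia

theorem natDegree_eq_zero_of_pow {R : Type*} [Semiring R] [NoZeroDivisors R] {p : R[X]} {n : ℕ}
    (hn : n ≠ 0) (h : (p ^ n).natDegree = 0) : p.natDegree = 0 := by
  rw [natDegree_pow] at h
  simpa [hn] using h

variable {K : Type*} [Field K]

/-- If `α Uᵐ + β Vⁿ` is a nonzero constant with `m, n ≥ 2`, then `U` and `V` are constant. -/
theorem natDegree_eq_zero_of_pow_add_pow [CharZero K] {U V : K[X]} {α β κ : K} {m n : ℕ}
    (hm : 2 ≤ m) (hn : 2 ≤ n) (hα : α ≠ 0) (hβ : β ≠ 0) (hκ : κ ≠ 0)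
    (h : Polynomial.C α * U ^ m + Polynomial.C β * V ^ n = Polynomial.C κ) :
    U.natDegree = 0 ∧ V.natDegree = 0 := by
  have hcop : IsCoprime U V := by
    refine ⟨Polynomial.C κ⁻¹ * Polynomial.C α * U ^ (m - 1),
      Polynomial.C κ⁻¹ * Polynomial.C β * V ^ (n - 1), ?_⟩
    have h1 : U ^ (m - 1) * U = U ^ m := by rw [← pow_succ]; congr 1; lia
    have h2 : V ^ (n - 1) * V = V ^ n := by rw [← pow_succ]; congr 1; lia
    calc _ = Polynomial.C κ⁻¹ *
          (Polynomial.C α * (U ^ (m - 1) * U) + Polynomial.C β * (V ^ (n - 1) * V)) := by ring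
      _ = 1 := by rw [h1, h2, h, ← Polynomial.C_mul, inv_mul_cancel₀ hκ, Polynomial.C_1]
  have hd := congrArg derivative h
  simp only [derivative_add, derivative_C_mul, derivative_pow, derivative_C] at hd
  have hdU : U ^ (m - 1) ∣ derivative V := by
    have h1 : U ^ (m - 1) ∣ V ^ (n - 1) * derivative V := by
      refine ⟨-(Polynomial.C (β * n)⁻¹ * Polynomial.C (α * m) * derivative U), ?_⟩
      have hβn : β * n ≠ 0 := mul_ne_zero hβ (by exact_mod_cast (by lia : n ≠ 0))
      have h3 : Polynomial.C (β * n)⁻¹ * Polynomial.C (β * n) = 1 := by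
        rw [← Polynomial.C_mul, inv_mul_cancel₀ hβn, Polynomial.C_1]
      have h4 : Polynomial.C (β * n) * (V ^ (n - 1) * derivative V) =
          -(Polynomial.C (α * m) * (U ^ (m - 1) * derivative U)) := by
        simp only [Polynomial.C_mul]
        linear_combination hd
      calc _ = Polynomial.C (β * n)⁻¹ * Polynomial.C (β * n) * (V ^ (n - 1) * derivative V) := by
            rw [h3, one_mul]
        _ = Polynomial.C (β * n)⁻¹ * (Polynomial.C (β * n) * (V ^ (n - 1) * derivative V)) := by
            ring
        _ = _ := by rw [h4]; ring
    exact (hcop.pow (m := m - 1) (n := n - 1)).dvd_of_dvd_mul_left h1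
  have hdV : V ^ (n - 1) ∣ derivative U := by
    have h1 : V ^ (n - 1) ∣ U ^ (m - 1) * derivative U := by
      refine ⟨-(Polynomial.C (α * m)⁻¹ * Polynomial.C (β * n) * derivative V), ?_⟩
      have hαm : α * m ≠ 0 := mul_ne_zero hα (by exact_mod_cast (by lia : m ≠ 0))
      have h3 : Polynomial.C (α * m)⁻¹ * Polynomial.C (α * m) = 1 := by
        rw [← Polynomial.C_mul, inv_mul_cancel₀ hαm, Polynomial.C_1]
      have h4 : Polynomial.C (α * m) * (U ^ (m - 1) * derivative U) =
          -(Polynomial.C (β * n) * (V ^ (n - 1) * derivative V)) := by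
        simp only [Polynomial.C_mul]
        linear_combination hd
      calc _ = Polynomial.C (α * m)⁻¹ * Polynomial.C (α * m) * (U ^ (m - 1) * derivative U) := by
            rw [h3, one_mul]
        _ = Polynomial.C (α * m)⁻¹ * (Polynomial.C (α * m) * (U ^ (m - 1) * derivative U)) := by
            ring
        _ = _ := by rw [h4]; ring
    exact (hcop.symm.pow (m := n - 1) (n := m - 1)).dvd_of_dvd_mul_left h1
  have key : ∀ {P Q : K[X]} {k : ℕ}, 2 ≤ k → P ^ (k - 1) ∣ derivative Q →
      Q.natDegree ≠ 0 → P.natDegree < Q.natDegree := by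
    intro P Q k hk hdvd hQ
    have h0 : derivative Q ≠ 0 := fun h0 => hQ (derivative_eq_zero.1 h0)
    have h1 := natDegree_le_of_dvd hdvd h0
    rw [natDegree_pow] at h1
    have h2 := natDegree_derivative_lt hQ
    have h3 : 1 * P.natDegree ≤ (k - 1) * P.natDegree := Nat.mul_le_mul_right _ (by lia)
    lia
  by_cases hU : U.natDegree = 0
  · refine ⟨hU, ?_⟩
    by_contra hV
    rw [eq_C_of_natDegree_eq_zero hU] at h
    have h5 : Polynomial.C β * V ^ n = Polynomial.C (κ - α * U.coeff 0 ^ m) := by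
      simp only [Polynomial.C_sub, Polynomial.C_mul, Polynomial.C_pow]
      linear_combination h
    have h6 := congrArg natDegree h5
    rw [natDegree_C_mul hβ, natDegree_pow, natDegree_C] at h6
    simp at h6
    lia
  · by_cases hV : V.natDegree = 0
    · exfalso
      rw [eq_C_of_natDegree_eq_zero hV] at h
      have h5 : Polynomial.C α * U ^ m = Polynomial.C (κ - β * V.coeff 0 ^ n) := by
        simp only [Polynomial.C_sub, Polynomial.C_mul, Polynomial.C_pow]
        linear_combination h
      have h6 := congrArg natDegree h5
      rw [natDegree_C_mul hα, natDegree_pow, natDegree_C] at h6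
      simp at h6
      lia
    · have h1 := key hm hdU hV
      have h2 := key hn hdV hU
      lia

variable [Algebra ℂ K]

/-- A nonzero constant value of a binary form of positive degree forces a constant linear form. -/
theorem natDegree_eq_zero_of_aeval_homogenize {V W : K[X]} {p : ℂ[X]} {r : ℕ}
    (hr : r ≠ 0) (hp : p.natDegree ≤ r)
    (h0 : MvPolynomial.aeval ![V, W] (p.homogenize r) ≠ 0)
    (h : (MvPolynomial.aeval ![V, W] (p.homogenize r)).natDegree = 0) :
    V.natDegree = 0 ∨ W.natDegree = 0 ∨
      ∃ ρ : ℂ, ρ ≠ 0 ∧ V - ρ • W ≠ 0 ∧ (V - ρ • W).natDegree = 0 := by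
  by_cases hd : p.natDegree = 0
  · right; left
    rw [eq_C_of_natDegree_eq_zero hd, homogenize_C] at h h0
    simp only [map_mul, map_pow, MvPolynomial.aeval_X, Matrix.cons_val_one] at h h0
    exact natDegree_eq_zero_of_pow hr (natDegree_eq_zero_right_of_mul h0 h)
  · obtain ⟨ρ, hρ⟩ := IsAlgClosed.exists_root p (by
      intro h1
      exact hd (natDegree_eq_zero_iff_degree_le_zero.2 h1.le))
    obtain ⟨q, rfl⟩ := dvd_iff_isRoot.2 hρ
    have hq : q ≠ 0 := by rintro rfl; simp at hd
    have hdq : q.natDegree ≤ r - 1 := by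
      rw [natDegree_mul (X_sub_C_ne_zero ρ) hq, natDegree_X_sub_C] at hp
      lia
    obtain ⟨s, rfl⟩ : ∃ s, r = 1 + s := ⟨r - 1, by lia⟩
    rw [homogenize_mul _ _ (natDegree_X_sub_C_le ρ) (by simpa using hdq), map_mul] at h h0
    have h1 : MvPolynomial.aeval ![V, W] ((Polynomial.X - Polynomial.C ρ).homogenize 1) =
        V - ρ • W := by
      rw [homogenize_sub, homogenize_X one_ne_zero, homogenize_C]
      simp [Algebra.smul_def]
    rw [h1] at h h0
    have h2 := natDegree_eq_zero_left_of_mul h0 h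
    by_cases hρ0 : ρ = 0
    · left; simpa [hρ0] using h2
    · exact Or.inr (Or.inr ⟨ρ, hρ0, left_ne_zero_of_mul h0, h2⟩)

/-- A nonzero constant value of a `(3, 2)`-weighted homogeneous polynomial of positive degree at
`(Z, T)` forces `Z`, `T` or some `Z² - ρ T³` with `ρ ≠ 0` to be constant. -/
theorem natDegree_eq_zero_of_weighted_sum {Z T : K[X]} {ι : Type*} {S : Finset ι} {c d : ι → ℕ}
    {a : ι → ℂ} {e : ℕ} (he : e ≠ 0) (hS : ∀ i ∈ S, 3 * c i + 2 * d i = e)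
    (h0 : ∑ i ∈ S, a i • (Z ^ c i * T ^ d i) ≠ 0)
    (h : (∑ i ∈ S, a i • (Z ^ c i * T ^ d i)).natDegree = 0) :
    Z.natDegree = 0 ∨ T.natDegree = 0 ∨
      ∃ ρ : ℂ, ρ ≠ 0 ∧ Z ^ 2 - ρ • T ^ 3 ≠ 0 ∧ (Z ^ 2 - ρ • T ^ 3).natDegree = 0 := by
  set c₀ := e % 2
  set d₀ := (2 * e) % 3
  set r := (e - 3 * c₀ - 2 * d₀) / 6
  have hk : ∀ i ∈ S, c i = c₀ + 2 * (c i / 2) ∧ d i = d₀ + 3 * (r - c i / 2) ∧ c i / 2 ≤ r := by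
    intro i hi
    have := hS i hi
    lia
  have hsum : ∑ i ∈ S, a i • (Z ^ c i * T ^ d i) = Z ^ c₀ * T ^ d₀ *
      MvPolynomial.aeval ![Z ^ 2, T ^ 3]
        ((∑ i ∈ S, Polynomial.monomial (c i / 2) (a i)).homogenize r) := by
    rw [homogenize_finsetSum, map_sum, Finset.mul_sum]
    refine Finset.sum_congr rfl fun i hi => ?_
    obtain ⟨h1, h2, h3⟩ := hk i hi
    rw [homogenize_monomial h3, MvPolynomial.aeval_monomial]
    have h4 : Z ^ c i = Z ^ c₀ * (Z ^ 2) ^ (c i / 2) := by rw [← pow_mul, ← pow_add, ← h1]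
    have h5 : T ^ d i = T ^ d₀ * (T ^ 3) ^ (r - c i / 2) := by rw [← pow_mul, ← pow_add, ← h2]
    rw [h4, h5]
    simp [Algebra.smul_def]
    ring
  rw [hsum] at h h0
  have hl := natDegree_eq_zero_left_of_mul h0 h
  have hl0 := left_ne_zero_of_mul h0
  by_cases hc : c₀ = 0
  · by_cases hd : d₀ = 0
    · have hr : r ≠ 0 := by lia
      rcases natDegree_eq_zero_of_aeval_homogenize hr
        (natDegree_sum_le_of_forall_le _ _ fun i hi =>
          (natDegree_monomial_le _).trans (hk i hi).2.2)
        (right_ne_zero_of_mul h0) (natDegree_eq_zero_right_of_mul h0 h) with h1 | h1 | h1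
      · exact Or.inl (natDegree_eq_zero_of_pow two_ne_zero h1)
      · exact Or.inr (Or.inl (natDegree_eq_zero_of_pow three_ne_zero h1))
      · exact Or.inr (Or.inr h1)
    · exact Or.inr (Or.inl (natDegree_eq_zero_of_pow hd (natDegree_eq_zero_right_of_mul hl0 hl)))
  · exact Or.inl (natDegree_eq_zero_of_pow hc (natDegree_eq_zero_left_of_mul hl0 hl))

/-- A polynomial curve on `X²Y + Z² + T³ = 0` along which `Y` and one further invariant
are constant is itself constant. -/
theorem natDegree_eq_zero_of_curve [CharZero K] {X Y Z T : K[X]} (hX : X ≠ 0) (hY : Y ≠ 0)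
    (hZ : Z ≠ 0) (hT : T ≠ 0) (hrel : X ^ 2 * Y + Z ^ 2 + T ^ 3 = 0) (hYc : Y.natDegree = 0)
    (h : X.natDegree = 0 ∨ Z.natDegree = 0 ∨ T.natDegree = 0 ∨
      ∃ ρ : ℂ, ρ ≠ 0 ∧ Z ^ 2 - ρ • T ^ 3 ≠ 0 ∧ (Z ^ 2 - ρ • T ^ 3).natDegree = 0) :
    X.natDegree = 0 ∧ Z.natDegree = 0 ∧ T.natDegree = 0 := by
  obtain ⟨y, rfl⟩ : ∃ y, Y = Polynomial.C y := ⟨_, eq_C_of_natDegree_eq_zero hYc⟩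
  have hy : y ≠ 0 := by rintro rfl; simp at hY
  have of_zt : Z.natDegree = 0 → T.natDegree = 0 →
      X.natDegree = 0 ∧ Z.natDegree = 0 ∧ T.natDegree = 0 := by
    intro h1 h2
    refine ⟨?_, h1, h2⟩
    rw [eq_C_of_natDegree_eq_zero h1, eq_C_of_natDegree_eq_zero h2] at hrel
    have h3 : X ^ 2 * Polynomial.C y = Polynomial.C (-(Z.coeff 0 ^ 2 + T.coeff 0 ^ 3)) := by
      simp only [Polynomial.C_neg, Polynomial.C_add, Polynomial.C_pow]
      linear_combination hrel
    have h4 := congrArg natDegree h3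
    rw [natDegree_C] at h4
    exact natDegree_eq_zero_of_pow two_ne_zero
      (natDegree_eq_zero_left_of_mul (mul_ne_zero (pow_ne_zero _ hX) hY) h4)
  rcases h with h | h | h | ⟨ρ, hρ, h0, h⟩
  · obtain ⟨x, rfl⟩ : ∃ x, X = Polynomial.C x := ⟨_, eq_C_of_natDegree_eq_zero h⟩
    have hx : x ≠ 0 := by rintro rfl; simp at hX
    obtain ⟨h1, h2⟩ := natDegree_eq_zero_of_pow_add_pow (U := Z) (V := T) (α := 1) (β := 1)
      (κ := -(x ^ 2 * y)) le_rfl (by norm_num : 2 ≤ 3) one_ne_zero one_ne_zero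
      (neg_ne_zero.2 (mul_ne_zero (pow_ne_zero _ hx) hy)) (by
        simp only [Polynomial.C_1, Polynomial.C_neg, Polynomial.C_mul, Polynomial.C_pow]
        linear_combination hrel)
    exact of_zt h1 h2
  · obtain ⟨z, rfl⟩ : ∃ z, Z = Polynomial.C z := ⟨_, eq_C_of_natDegree_eq_zero h⟩
    have hz : z ≠ 0 := by rintro rfl; simp at hZ
    obtain ⟨h1, h2⟩ := natDegree_eq_zero_of_pow_add_pow (U := X) (V := T) (α := y) (β := 1)
      (κ := -(z ^ 2)) le_rfl (by norm_num : 2 ≤ 3) hy one_ne_zero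
      (neg_ne_zero.2 (pow_ne_zero _ hz)) (by
        simp only [Polynomial.C_1, Polynomial.C_neg, Polynomial.C_pow]
        linear_combination hrel)
    exact ⟨h1, h, h2⟩
  · obtain ⟨t, rfl⟩ : ∃ t, T = Polynomial.C t := ⟨_, eq_C_of_natDegree_eq_zero h⟩
    have ht : t ≠ 0 := by rintro rfl; simp at hT
    obtain ⟨h1, h2⟩ := natDegree_eq_zero_of_pow_add_pow (U := X) (V := Z) (α := y) (β := 1)
      (κ := -(t ^ 3)) le_rfl le_rfl hy one_ne_zero
      (neg_ne_zero.2 (pow_ne_zero _ ht)) (by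
        simp only [Polynomial.C_1, Polynomial.C_neg, Polynomial.C_pow]
        linear_combination hrel)
    exact ⟨h1, h2, h⟩
  · obtain ⟨κ, hκ⟩ : ∃ κ, Z ^ 2 - ρ • T ^ 3 = Polynomial.C κ := ⟨_, eq_C_of_natDegree_eq_zero h⟩
    have hκ0 : κ ≠ 0 := by rintro rfl; simp [hκ] at h0
    obtain ⟨h1, h2⟩ := natDegree_eq_zero_of_pow_add_pow (U := Z) (V := T) (α := 1)
      (β := -algebraMap ℂ K ρ) (κ := κ) le_rfl (by norm_num : 2 ≤ 3) one_ne_zero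
      (neg_ne_zero.2 (by simpa using hρ)) hκ0 (by
        rw [← hκ, Algebra.smul_def, Polynomial.algebraMap_apply]
        simp only [Polynomial.C_1, Polynomial.C_neg]
        ring)
    exact of_zt h1 h2

end Univariate

section TopForm

variable {R Γ : Type*} [CommRing R] [LinearOrder Γ]

/-- All weights of `p` are at most `γ`, and the coefficient of `p` in weight `γ` is `c`
(possibly zero). -/
def IsTopForm (p : AddMonoidAlgebra R Γ) (γ : Γ) (c : R) : Prop :=
  p.coeff γ = c ∧ ∀ γ', γ < γ' → p.coeff γ' = 0

namespace IsTopForm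

theorem single (γ : Γ) (c : R) : IsTopForm (AddMonoidAlgebra.single γ c) γ c := by
  classical
  refine ⟨by simp, fun γ' h => ?_⟩
  rw [AddMonoidAlgebra.coeff_single, Finsupp.single_apply, if_neg h.ne]

theorem of_lt {p : AddMonoidAlgebra R Γ} {γ γ' : Γ} {c : R} (h : IsTopForm p γ c) (hγ : γ < γ') :
    IsTopForm p γ' 0 :=
  ⟨h.2 _ hγ, fun _ h' => h.2 _ (hγ.trans h')⟩

theorem zero (γ : Γ) : IsTopForm (0 : AddMonoidAlgebra R Γ) γ 0 := ⟨by simp, by simp⟩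

theorem add {p q : AddMonoidAlgebra R Γ} {γ : Γ} {c d : R} (hp : IsTopForm p γ c)
    (hq : IsTopForm q γ d) : IsTopForm (p + q) γ (c + d) :=
  ⟨by simp [hp.1, hq.1], fun γ' h => by simp [hp.2 γ' h, hq.2 γ' h]⟩

theorem smul {A : Type*} [CommSemiring A] [Algebra A R] {p : AddMonoidAlgebra R Γ} {γ : Γ} {c : R}
    (a : A) (hp : IsTopForm p γ c) : IsTopForm (a • p) γ (a • c) :=
  ⟨by simp [hp.1], fun γ' h => by simp [hp.2 γ' h]⟩

theorem sum {ι : Type*} {s : Finset ι} {p : ι → AddMonoidAlgebra R Γ} {γ : Γ} {c : ι → R}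
    (hp : ∀ i ∈ s, IsTopForm (p i) γ (c i)) : IsTopForm (∑ i ∈ s, p i) γ (∑ i ∈ s, c i) := by
  classical
  induction s using Finset.induction_on with
  | empty => simpa using zero γ
  | insert i s hi ih =>
    rw [Finset.sum_insert hi, Finset.sum_insert hi]
    exact (hp i (by simp)).add (ih fun j hj => hp j (by simp [hj]))

theorem unique {p : AddMonoidAlgebra R Γ} {γ : Γ} {c d : R} (hp : IsTopForm p γ c)
    (hq : IsTopForm p γ d) : c = d := hp.1.symm.trans hq.1

variable [AddCommGroup Γ] [IsOrderedAddMonoid Γ]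

theorem mul {p q : AddMonoidAlgebra R Γ} {γ δ : Γ} {c d : R} (hp : IsTopForm p γ c)
    (hq : IsTopForm q δ d) : IsTopForm (p * q) (γ + δ) (c * d) := by
  constructor
  · rw [AddMonoidAlgebra.coeff_mul_apply_left, Finsupp.sum, Finset.sum_eq_single γ]
    · rw [hp.1, neg_add_cancel_left, hq.1]
    · intro b hb hne
      have h1 : b < γ := lt_of_le_of_ne (not_lt.1 fun h => Finsupp.mem_support_iff.1 hb (hp.2 b h))
        hne
      rw [hq.2, mul_zero]
      rw [add_comm γ, ← add_assoc, add_right_comm, add_comm]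
      simpa using h1
    · intro h
      rw [Finsupp.notMem_support_iff.1 h, zero_mul]
  · intro γ' h
    rw [AddMonoidAlgebra.coeff_mul_apply_left, Finsupp.sum, Finset.sum_eq_zero]
    intro b hb
    have h1 : b ≤ γ := not_lt.1 fun h => Finsupp.mem_support_iff.1 hb (hp.2 b h)
    rw [hq.2, mul_zero]
    rw [lt_neg_add_iff_add_lt]
    exact lt_of_le_of_lt (by gcongr) h

theorem pow {p : AddMonoidAlgebra R Γ} {γ : Γ} {c : R} (hp : IsTopForm p γ c) (n : ℕ) :
    IsTopForm (p ^ n) (n • γ) (c ^ n) := by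
  induction n with
  | zero => simpa [AddMonoidAlgebra.one_def] using single (0 : Γ) (1 : R)
  | succ n ih =>
    rw [pow_succ, pow_succ, succ_nsmul]
    exact ih.mul hp

/-- The top form of a polynomial expression. -/
theorem aeval {A : Type*} [CommSemiring A] [Algebra A R] {n : ℕ}
    {g : Fin n → AddMonoidAlgebra R Γ} {w : Fin n → Γ} {c : Fin n → R}
    (h : ∀ i, IsTopForm (g i) (w i) (c i)) (P : MvPolynomial (Fin n) A) (γ : Γ)
    (hγ : ∀ m ∈ P.support, ∑ i, m i • w i ≤ γ) :
    IsTopForm (MvPolynomial.aeval g P) γ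
      (∑ m ∈ P.support with ∑ i, m i • w i = γ, P.coeff m • ∏ i, c i ^ m i) := by
  have hprod : ∀ (m : Fin n →₀ ℕ) (s : Finset (Fin n)),
      IsTopForm (∏ i ∈ s, g i ^ m i) (∑ i ∈ s, m i • w i) (∏ i ∈ s, c i ^ m i) := by
    intro m s
    induction s using Finset.induction_on with
    | empty => simpa [AddMonoidAlgebra.one_def] using single (0 : Γ) (1 : R)
    | insert i s hi ih =>
      rw [Finset.prod_insert hi, Finset.prod_insert hi, Finset.sum_insert hi]
      exact ((h i).pow _).mul ih
  rw [aeval_def, eval₂_eq', Finset.sum_filter]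
  refine sum fun m hm => ?_
  have h1 := (hprod m Finset.univ).smul (P.coeff m)
  rw [Algebra.smul_def] at h1
  split_ifs with h2
  · exact h2 ▸ h1
  · exact h1.of_lt (lt_of_le_of_ne (hγ m hm) h2)

end IsTopForm

end TopForm

section Weights

theorem Hyperreal.natCast_lt_omega (n : ℕ) : (n : ℝ*) < Hyperreal.omega := by
  have h := Hyperreal.coe_lt_omega (n : ℝ)
  have h1 : ((n : ℝ) : ℝ*) = (n : ℝ*) := map_natCast Hyperreal.coeRingHom n
  rwa [h1] at h

theorem Hyperreal.mul_omega_add_lt {i i' : ℤ} {j j' : ℕ} (h : i < i') :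
    (i : ℝ*) * Hyperreal.omega + j < i' * Hyperreal.omega + j' := by
  have h1 : (i : ℝ*) + 1 ≤ i' := by exact_mod_cast h
  have h2 := Hyperreal.natCast_lt_omega j
  have h3 : ((i : ℝ*) + 1) * Hyperreal.omega ≤ i' * Hyperreal.omega :=
    mul_le_mul_of_nonneg_right h1 Hyperreal.omega_pos.le
  have h4 : (0 : ℝ*) ≤ j' := Nat.cast_nonneg j'
  linarith

theorem Hyperreal.mul_omega_add_inj {i i' : ℤ} {j j' : ℕ}
    (h : (i : ℝ*) * Hyperreal.omega + j = i' * Hyperreal.omega + j') : i = i' ∧ j = j' := by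
  have hi : i = i' := by
    rcases lt_trichotomy i i' with h1 | h1 | h1
    · exact absurd h (Hyperreal.mul_omega_add_lt h1).ne
    · exact h1
    · exact absurd h (Hyperreal.mul_omega_add_lt h1).ne'
  subst hi
  exact ⟨rfl, by exact_mod_cast add_left_cancel h⟩

/-- The weights of the four generators; `x` has infinitely negative weight. -/
noncomputable def russellWeight : Fin 4 → ℝ* := ![-Hyperreal.omega, 6 + 2 * Hyperreal.omega, 3, 2]

theorem sum_smul_russellWeight (m : Fin 4 →₀ ℕ) : ∑ i, m i • russellWeight i =
    ((2 * m 1 - m 0 : ℤ) : ℝ*) * Hyperreal.omega + (6 * m 1 + 3 * m 2 + 2 * m 3 : ℕ) := by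
  simp [Fin.sum_univ_four, russellWeight]
  ring

theorem eq_and_eq_of_two_mul_sub_eq {a b a' b' : ℕ} (h : (2 * b - a : ℤ) = 2 * b' - a')
    (hab : a ≤ 1 ∨ b = 0) (hab' : a' ≤ 1 ∨ b' = 0) : a = a' ∧ b = b' := by
  omega

/-- The homogeneous top form of a polynomial in normal form with respect to `x²y`. -/
theorem exists_isTopForm_aeval {P : MvPolynomial (Fin 4) ℂ} (hP : P ≠ 0)
    (hn : ∀ m ∈ P.support, m 0 ≤ 1 ∨ m 1 = 0) :
    ∃ S : Finset (Fin 4 →₀ ℕ), S.Nonempty ∧ S ⊆ P.support ∧ ∃ a b e : ℕ,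
      (∀ m ∈ S, m 0 = a ∧ m 1 = b ∧ 3 * m 2 + 2 * m 3 = e) ∧
      ∀ (R : Type) [CommRing R] [Algebra ℂ R] (g : Fin 4 → AddMonoidAlgebra R ℝ*)
        (c : Fin 4 → R), (∀ i, IsTopForm (g i) (russellWeight i) (c i)) →
        IsTopForm (aeval g P) (((2 * b - a : ℤ) : ℝ*) * Hyperreal.omega + (6 * b + e : ℕ))
          (c 0 ^ a * c 1 ^ b * ∑ m ∈ S, P.coeff m • (c 2 ^ m 2 * c 3 ^ m 3)) := by
  obtain ⟨m₀, hm₀, hmax⟩ := Finset.exists_max_image P.support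
    (fun m => ∑ i, m i • russellWeight i) (support_nonempty.2 hP)
  refine ⟨{m ∈ P.support | ∑ i, m i • russellWeight i = ∑ i, m₀ i • russellWeight i},
    ⟨m₀, by simpa using hm₀⟩, Finset.filter_subset _ _, m₀ 0, m₀ 1, 3 * m₀ 2 + 2 * m₀ 3, ?_, ?_⟩
  · intro m hm
    rw [Finset.mem_filter, sum_smul_russellWeight, sum_smul_russellWeight] at hm
    obtain ⟨h1, h2⟩ := Hyperreal.mul_omega_add_inj hm.2
    obtain ⟨h3, h4⟩ := eq_and_eq_of_two_mul_sub_eq h1 (hn m hm.1) (hn m₀ hm₀)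
    exact ⟨h3, h4, by omega⟩
  · intro R _ _ g c h
    have h1 := IsTopForm.aeval h P _ hmax
    convert h1 using 1
    · rw [sum_smul_russellWeight, add_assoc (6 * m₀ 1)]
    · rw [Finset.mul_sum]
      refine Finset.sum_congr rfl fun m hm => ?_
      rw [Finset.mem_filter, sum_smul_russellWeight, sum_smul_russellWeight] at hm
      obtain ⟨h1, h2⟩ := Hyperreal.mul_omega_add_inj hm.2
      obtain ⟨h5, h6⟩ := eq_and_eq_of_two_mul_sub_eq h1 (hn m hm.1) (hn m₀ hm₀)
      rw [Fin.prod_univ_four, h5, h6, mul_smul_comm]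
      ring_nf

end Weights

namespace RussellCubicRing

/-- The images of the coordinates `x`, `y`, `z`, `t`. -/
noncomputable def gen (i : Fin 4) : RussellCubicRing := Ideal.Quotient.mk _ (X i)

theorem gen_relation : gen 0 + gen 0 ^ 2 * gen 1 + gen 2 ^ 2 + gen 3 ^ 3 = 0 := by
  simp only [gen, ← map_pow, ← map_mul, ← map_add]
  exact Ideal.Quotient.eq_zero_iff_mem.2 (Ideal.subset_span rfl)

theorem mk_eq_aeval (P : MvPolynomial (Fin 4) ℂ) :
    (Ideal.Quotient.mk _ P : RussellCubicRing) = aeval gen P := by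
  have h : (Ideal.Quotient.mkₐ ℂ _ : MvPolynomial (Fin 4) ℂ →ₐ[ℂ] RussellCubicRing) =
      aeval gen := by
    ext i
    simp [gen]
  exact congrArg (fun f => f P) h

theorem adjoin_range_gen : Algebra.adjoin ℂ (Set.range gen) = ⊤ := by
  rw [Algebra.adjoin_range_eq_range_aeval, AlgHom.range_eq_top]
  intro b
  obtain ⟨P, rfl⟩ := Ideal.Quotient.mk_surjective b
  exact ⟨P, (mk_eq_aeval P).symm⟩

theorem exists_normal_form (f : RussellCubicRing) : ∃ P : MvPolynomial (Fin 4) ℂ,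
    aeval gen P = f ∧ ∀ m ∈ P.support, m 0 ≤ 1 ∨ m 1 = 0 := by
  let N : Submodule ℂ (MvPolynomial (Fin 4) ℂ) := MvPolynomial.restrictSupport ℂ
    {m | m 0 ≤ 1 ∨ m 1 = 0}
  let M : Submodule ℂ RussellCubicRing := N.map (aeval gen).toLinearMap
  have mono : ∀ a b c d : ℕ, (a ≤ 1 ∨ b = 0) →
      gen 0 ^ a * gen 1 ^ b * gen 2 ^ c * gen 3 ^ d ∈ M := by
    intro a b c d h
    refine ⟨monomial (Finsupp.equivFunOnFinite.symm ![a, b, c, d]) 1,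
      (monomial_mem_restrictSupport ℂ).2 (Or.inl ?_), ?_⟩
    · simpa using h
    · simp [aeval_monomial, Finsupp.prod_fintype, Fin.prod_univ_four]
  have key : ∀ b a c d : ℕ, gen 0 ^ a * gen 1 ^ b * gen 2 ^ c * gen 3 ^ d ∈ M := by
    intro b
    induction b with
    | zero => exact fun a c d => mono a 0 c d (Or.inr rfl)
    | succ b ih =>
      intro a c d
      by_cases ha : a ≤ 1
      · exact mono a (b + 1) c d (Or.inl ha)
      · obtain ⟨a, rfl⟩ : ∃ k, a = k + 2 := ⟨a - 2, by omega⟩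
        have h : gen 0 ^ (a + 2) * gen 1 ^ (b + 1) * gen 2 ^ c * gen 3 ^ d =
            -(gen 0 ^ (a + 1) * gen 1 ^ b * gen 2 ^ c * gen 3 ^ d) -
            gen 0 ^ a * gen 1 ^ b * gen 2 ^ (c + 2) * gen 3 ^ d -
            gen 0 ^ a * gen 1 ^ b * gen 2 ^ c * gen 3 ^ (d + 3) := by
          linear_combination gen 0 ^ a * gen 1 ^ b * gen 2 ^ c * gen 3 ^ d * gen_relation
        rw [h]
        exact M.sub_mem (M.sub_mem (M.neg_mem (ih _ _ _)) (ih _ _ _)) (ih _ _ _)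
  obtain ⟨Q, rfl⟩ := Ideal.Quotient.mk_surjective f
  have h : (Ideal.Quotient.mk _ Q : RussellCubicRing) ∈ M := by
    rw [mk_eq_aeval, aeval_def, eval₂_eq']
    refine M.sum_mem fun m _ => ?_
    rw [← Algebra.smul_def, Fin.prod_univ_four]
    exact M.smul_mem _ (key _ _ _ _)
  obtain ⟨P, hP, hPf⟩ := h
  exact ⟨P, hPf, fun m hm => (mem_restrictSupport_iff ..).1 hP hm⟩

/-- The field of rational functions in `x`, `z`, `t`. -/
abbrev CoordField : Type := FractionRing (MvPolynomial (Fin 3) ℂ)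

/-- The top forms of the generators. -/
noncomputable def topCoord : Fin 4 → CoordField :=
  ![algebraMap (MvPolynomial (Fin 3) ℂ) CoordField (X 0),
    -((algebraMap (MvPolynomial (Fin 3) ℂ) CoordField (X 1) ^ 2 +
      algebraMap (MvPolynomial (Fin 3) ℂ) CoordField (X 2) ^ 3) /
        algebraMap (MvPolynomial (Fin 3) ℂ) CoordField (X 0) ^ 2),
    algebraMap (MvPolynomial (Fin 3) ℂ) CoordField (X 1),
    algebraMap (MvPolynomial (Fin 3) ℂ) CoordField (X 2)]

theorem topCoord_zero_ne_zero : topCoord 0 ≠ 0 := by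
  simp [topCoord]

theorem topCoord_relation :
    topCoord 0 ^ 2 * topCoord 1 + topCoord 2 ^ 2 + topCoord 3 ^ 3 = 0 := by
  have h := topCoord_zero_ne_zero
  simp only [topCoord, Matrix.cons_val] at h ⊢
  field_simp
  ring

theorem sum_topCoord_ne_zero {S : Finset (Fin 4 →₀ ℕ)} (hS : S.Nonempty)
    {c : (Fin 4 →₀ ℕ) → ℂ} (hc : ∀ m ∈ S, c m ≠ 0)
    {a b : ℕ} (hab : ∀ m ∈ S, m 0 = a ∧ m 1 = b) :
    ∑ m ∈ S, c m • (topCoord 2 ^ m 2 * topCoord 3 ^ m 3) ≠ 0 := by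
  obtain ⟨m₀, hm₀⟩ := hS
  let v : (Fin 4 →₀ ℕ) → (Fin 3 →₀ ℕ) := fun m =>
    Finsupp.equivFunOnFinite.symm ![0, m 2, m 3]
  have h : ∑ m ∈ S, c m • (topCoord 2 ^ m 2 * topCoord 3 ^ m 3) =
      algebraMap (MvPolynomial (Fin 3) ℂ) CoordField (∑ m ∈ S, monomial (v m) (c m)) := by
    rw [map_sum]
    refine Finset.sum_congr rfl fun m _ => ?_
    rw [monomial_eq, Finsupp.prod_fintype _ _ (by simp), Fin.prod_univ_three]
    simp [v, topCoord, Algebra.smul_def, IsScalarTower.algebraMap_apply ℂ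
      (MvPolynomial (Fin 3) ℂ) CoordField]
  rw [h, Ne, map_eq_zero_iff _ (IsFractionRing.injective _ _)]
  intro h0
  apply hc m₀ hm₀
  have h1 := congrArg (coeff (v m₀)) h0
  rw [coeff_sum, Finset.sum_eq_single m₀] at h1
  · simpa using h1
  · intro m hm hne
    rw [coeff_monomial, if_neg]
    intro h2
    apply hne
    have h3 := DFunLike.congr_fun h2 1
    have h4 := DFunLike.congr_fun h2 2
    ext i
    fin_cases i
    · exact (hab m hm).1.trans (hab m₀ hm₀).1.symm
    · exact (hab m hm).2.trans (hab m₀ hm₀).2.symm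
    · simpa [v] using h3
    · simpa [v] using h4
  · exact fun h => absurd hm₀ h

theorem topCoord_ne_zero (i : Fin 4) : topCoord i ≠ 0 := by
  fin_cases i
  · exact topCoord_zero_ne_zero
  · intro h
    have h1 := topCoord_relation
    have h2 : topCoord 1 = 0 := h
    rw [h2, mul_zero, zero_add] at h1
    refine sum_topCoord_ne_zero
      (S := {Finsupp.single 2 2, Finsupp.single 3 3}) (c := 1) (a := 0) (b := 0)
      (by simp) (by simp) (by simp) ?_
    rw [Finset.sum_pair, ← h1]
    · simp
    · intro h
      have := DFunLike.congr_fun h 2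
      simp at this
  · simp [topCoord]
  · simp [topCoord]

/-- The images of the generators under `laurent`. -/
noncomputable def laurentGen : Fin 4 → AddMonoidAlgebra CoordField ℝ* :=
  ![.single (-Hyperreal.omega) (topCoord 0),
    .single (6 + 2 * Hyperreal.omega) (topCoord 1) +
      .single Hyperreal.omega (-(topCoord 0)⁻¹),
    .single 3 (topCoord 2), .single 2 (topCoord 3)]

theorem laurentGen_relation :
    laurentGen 0 + laurentGen 0 ^ 2 * laurentGen 1 + laurentGen 2 ^ 2 + laurentGen 3 ^ 3 = 0 := by
  have h := topCoord_zero_ne_zero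
  simp only [laurentGen, Matrix.cons_val, AddMonoidAlgebra.single_pow, mul_add,
    AddMonoidAlgebra.single_mul_single]
  rw [show 2 • -Hyperreal.omega + (6 + 2 * Hyperreal.omega) = 6 by simp,
    show 2 • -Hyperreal.omega + Hyperreal.omega = -Hyperreal.omega by simp; ring,
    show topCoord 0 ^ 2 * -(topCoord 0)⁻¹ = -topCoord 0 by field_simp,
    show 2 • (3 : ℝ*) = 6 by norm_num, show 3 • (2 : ℝ*) = 6 by norm_num,
    AddMonoidAlgebra.single_neg]
  have key := congrArg (AddMonoidAlgebra.single (6 : ℝ*)) topCoord_relation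
  rw [AddMonoidAlgebra.single_add, AddMonoidAlgebra.single_add, AddMonoidAlgebra.single_zero] at key
  linear_combination key

/-- The embedding of the Russell cubic ring into Laurent polynomials given by solving for `y`. -/
noncomputable def laurent : RussellCubicRing →ₐ[ℂ] AddMonoidAlgebra CoordField ℝ* :=
  Ideal.Quotient.liftₐ _ (aeval laurentGen) fun a ha => by
    change a ∈ RingHom.ker (aeval laurentGen)
    refine (Ideal.span_le.2 ?_ : Ideal.span _ ≤ _) ha
    rintro _ rfl
    simpa using laurentGen_relation

theorem laurent_gen (i : Fin 4) : laurent (gen i) = laurentGen i := by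
  exact (Ideal.Quotient.lift_mk _ _ _).trans (aeval_X _ _)

theorem isTopForm_laurent_gen (i : Fin 4) :
    IsTopForm (laurent (gen i)) (russellWeight i) (topCoord i) := by
  rw [laurent_gen]
  fin_cases i
  · exact .single _ _
  · have h : IsTopForm (laurentGen 1) (russellWeight 1) (topCoord 1 + 0) := by
      refine (IsTopForm.single _ _).add ((IsTopForm.single _ _).of_lt ?_)
      have := Hyperreal.omega_pos
      change Hyperreal.omega < 6 + 2 * Hyperreal.omega
      linarith
    simpa using h
  · exact .single _ _
  · exact .single _ _

/-- The shape of the top form of a nonzero element, which persists under every homomorphism to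
Laurent polynomials for which the generators have the expected weights. -/
theorem exists_isTopForm {f : RussellCubicRing} (hf : f ≠ 0) :
    ∃ (S : Finset (Fin 4 →₀ ℕ)) (c : (Fin 4 →₀ ℕ) → ℂ) (a b e : ℕ),
      (∀ m ∈ S, 3 * m 2 + 2 * m 3 = e) ∧
      topCoord 0 ^ a * topCoord 1 ^ b * ∑ m ∈ S, c m • (topCoord 2 ^ m 2 * topCoord 3 ^ m 3) ≠ 0 ∧
      ∀ (R : Type) [CommRing R] [Algebra ℂ R] (Φ : RussellCubicRing →ₐ[ℂ] AddMonoidAlgebra R ℝ*)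
        (d : Fin 4 → R), (∀ i, IsTopForm (Φ (gen i)) (russellWeight i) (d i)) →
        IsTopForm (Φ f) (((2 * b - a : ℤ) : ℝ*) * Hyperreal.omega + (6 * b + e : ℕ))
          (d 0 ^ a * d 1 ^ b * ∑ m ∈ S, c m • (d 2 ^ m 2 * d 3 ^ m 3)) := by
  obtain ⟨P, rfl, hP⟩ := exists_normal_form f
  have hP0 : P ≠ 0 := by
    rintro rfl
    simp at hf
  obtain ⟨S, hS, hSP, a, b, e, hm, h⟩ := exists_isTopForm_aeval hP0 hP
  refine ⟨S, fun m => P.coeff m, a, b, e, fun m hmS => (hm m hmS).2.2, ?_, ?_⟩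
  · refine mul_ne_zero (mul_ne_zero (pow_ne_zero _ (topCoord_ne_zero 0))
      (pow_ne_zero _ (topCoord_ne_zero 1))) (sum_topCoord_ne_zero hS
        (fun m hmS => mem_support_iff.1 (hSP hmS)) fun m hmS => ⟨(hm m hmS).1, (hm m hmS).2.1⟩)
  · intro R _ _ Φ d hΦ
    rw [← AlgHom.comp_apply, comp_aeval]
    exact h R _ _ hΦ

theorem aeval_gen_ne_zero {P : MvPolynomial (Fin 4) ℂ} (hP : P ≠ 0)
    (hn : ∀ m ∈ P.support, m 0 ≤ 1 ∨ m 1 = 0) : aeval gen P ≠ 0 := by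
  obtain ⟨S, hS, hSP, a, b, e, hm, h⟩ := exists_isTopForm_aeval hP hn
  intro h0
  have h1 := h CoordField _ _ isTopForm_laurent_gen
  have h2 : aeval (fun i => laurent (gen i)) P = laurent (aeval gen P) := by
    rw [← AlgHom.comp_apply, comp_aeval]
  rw [h2, h0, map_zero] at h1
  refine mul_ne_zero (mul_ne_zero (pow_ne_zero _ (topCoord_ne_zero 0))
      (pow_ne_zero _ (topCoord_ne_zero 1))) (sum_topCoord_ne_zero hS
        (fun m hmS => mem_support_iff.1 (hSP hmS)) fun m hmS => ⟨(hm m hmS).1, (hm m hmS).2.1⟩)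
        (h1.unique (IsTopForm.zero _))

theorem laurent_injective : Function.Injective laurent := by
  rw [injective_iff_map_eq_zero]
  intro f hf
  by_contra hf0
  obtain ⟨S, c, a, b, e, -, h, h1⟩ := exists_isTopForm hf0
  have h2 := h1 CoordField laurent _ isTopForm_laurent_gen
  rw [hf] at h2
  exact h (h2.unique (IsTopForm.zero _))

instance : IsDomain RussellCubicRing :=
  laurent_injective.isDomain laurent.toRingHom

/-- Extend `laurent` to polynomials by giving the variable the weight `-δ`. -/
noncomputable def polynomialLaurent (δ : ℝ*) :
    Polynomial RussellCubicRing →ₐ[ℂ] AddMonoidAlgebra (Polynomial CoordField) ℝ* :=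
  Polynomial.eval₂AlgHom
    ((AddMonoidAlgebra.mapAlgHom ℝ* (Polynomial.CAlgHom : CoordField →ₐ[ℂ] _)).comp laurent)
    (AddMonoidAlgebra.single (-δ) Polynomial.X) fun _ => by
      rw [commute_iff_eq]
      ring

theorem polynomialLaurent_C (δ : ℝ*) (f : RussellCubicRing) :
    polynomialLaurent δ (Polynomial.C f) =
      AddMonoidAlgebra.mapAlgHom ℝ* (Polynomial.CAlgHom : CoordField →ₐ[ℂ] _) (laurent f) := by
  simp [polynomialLaurent]

theorem polynomialLaurent_coeff (δ γ : ℝ*) (n : ℕ) (q : Polynomial RussellCubicRing) :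
    ((polynomialLaurent δ q).coeff γ).coeff n = (laurent (q.coeff n)).coeff (γ + n • δ) := by
  induction q using Polynomial.induction_on' with
  | add p q hp hq => simp [hp, hq]
  | monomial k a =>
    have h : polynomialLaurent δ (Polynomial.monomial k a) =
        AddMonoidAlgebra.mapAlgHom ℝ* (Polynomial.CAlgHom : CoordField →ₐ[ℂ] _) (laurent a) *
          AddMonoidAlgebra.single (-δ) Polynomial.X ^ k := by simp [polynomialLaurent]
    rw [h, AddMonoidAlgebra.single_pow, AddMonoidAlgebra.coeff_mul_single_apply,
      AddMonoidAlgebra.coeff_mapAlgHom, Polynomial.CAlgHom_apply, Polynomial.coeff_C_mul_X_pow,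
      Polynomial.coeff_monomial]
    simp only [eq_comm (a := n)]
    split_ifs with hk
    · simp [hk]
    · simp

/-- A nontrivial exponential-type map induces, on top forms, a nontrivial deformation of the
top forms of the generators. -/
theorem exists_deformation (φ : RussellCubicRing →ₐ[ℂ] Polynomial RussellCubicRing)
    (h0 : ∀ f, (φ f).coeff 0 = f) (hφ : ∃ f, φ f ≠ Polynomial.C f) :
    ∃ (Ψ : RussellCubicRing →ₐ[ℂ] AddMonoidAlgebra (Polynomial CoordField) ℝ*)
      (d : Fin 4 → Polynomial CoordField),
      (∀ i, IsTopForm (Ψ (gen i)) (russellWeight i) (d i)) ∧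
      (∀ i, (d i).coeff 0 = topCoord i) ∧ (∃ i, (d i).natDegree ≠ 0) ∧
      ∀ f, φ f = Polynomial.C f → ∀ γ, (Ψ f).coeff γ = Polynomial.C ((laurent f).coeff γ) := by
  obtain ⟨j, hj⟩ : ∃ i, φ (gen i) ≠ Polynomial.C (gen i) := by
    by_contra! h
    obtain ⟨f, hf⟩ := hφ
    have h1 : φ = Polynomial.CAlgHom :=
      AlgHom.ext_of_adjoin_eq_top adjoin_range_gen (by rintro _ ⟨i, rfl⟩; exact h i)
    exact hf (by rw [h1]; rfl)
  let F : Finset (Σ _ : Fin 4, Σ _ : ℕ, ℝ*) := Finset.univ.sigma fun i =>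
    ((φ (gen i)).support.erase 0).sigma fun n => (laurent ((φ (gen i)).coeff n)).coeff.support
  have memF : ∀ i n γ, (⟨i, n, γ⟩ : Σ _ : Fin 4, Σ _ : ℕ, ℝ*) ∈ F ↔
      n ≠ 0 ∧ (laurent ((φ (gen i)).coeff n)).coeff γ ≠ 0 := by
    intro i n γ
    simp only [F, Finset.mem_sigma, Finset.mem_univ, true_and, Finset.mem_erase,
      Polynomial.mem_support_iff, Finsupp.mem_support_iff, and_assoc]
    refine and_congr_right fun _ => and_iff_right_of_imp fun h h1 => h ?_
    simp [h1]
  have hF : F.Nonempty := by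
    have h1 : ∃ n, n ≠ 0 ∧ (φ (gen j)).coeff n ≠ 0 := by
      by_contra! h1
      refine hj (Polynomial.ext fun n => ?_)
      rcases eq_or_ne n 0 with rfl | hn
      · simp [h0]
      · rw [h1 n hn, Polynomial.coeff_C, if_neg hn]
    obtain ⟨n, hn, hn0⟩ := h1
    have h2 : (laurent ((φ (gen j)).coeff n)).coeff ≠ 0 := by
      intro h2
      refine hn0 (laurent_injective ?_)
      rw [map_zero]
      ext γ
      simp [h2]
    obtain ⟨γ, hγ⟩ := Finsupp.ne_iff.1 h2
    exact ⟨⟨j, n, γ⟩, (memF _ _ _).2 ⟨hn, hγ⟩⟩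
  obtain ⟨⟨i₁, n₁, γ₁⟩, hmem, hmax⟩ := Finset.exists_max_image F
    (fun p => (p.2.2 - russellWeight p.1) / p.2.1) hF
  rw [memF] at hmem
  set δ : ℝ* := (γ₁ - russellWeight i₁) / n₁ with hδ
  refine ⟨(polynomialLaurent δ).comp φ, fun i => (polynomialLaurent δ (φ (gen i))).coeff
    (russellWeight i), fun i => ⟨rfl, fun γ hγ => ?_⟩, fun i => ?_, ⟨i₁, fun h => ?_⟩, ?_⟩
  · ext n
    rw [AlgHom.comp_apply, polynomialLaurent_coeff, Polynomial.coeff_zero]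
    rcases eq_or_ne n 0 with rfl | hn
    · rw [h0, zero_smul, add_zero]
      exact (isTopForm_laurent_gen i).2 γ hγ
    · by_contra h
      have h1 : (γ + n • δ - russellWeight i) / n ≤ δ := hmax ⟨i, n, _⟩ ((memF _ _ _).2 ⟨hn, h⟩)
      rw [div_le_iff₀ (by positivity), nsmul_eq_mul] at h1
      linarith
  · rw [polynomialLaurent_coeff, h0, zero_smul, add_zero]
    exact (isTopForm_laurent_gen i).1
  · have h1 := Polynomial.coeff_eq_zero_of_natDegree_lt (h.trans_lt (Nat.pos_of_ne_zero hmem.1))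
    rw [polynomialLaurent_coeff] at h1
    refine hmem.2 ?_
    convert h1 using 2
    have : (n₁ : ℝ*) ≠ 0 := Nat.cast_ne_zero.2 hmem.1
    rw [nsmul_eq_mul, hδ]
    field_simp
    ring
  · intro f hf γ
    rw [AlgHom.comp_apply, hf, polynomialLaurent_C, AddMonoidAlgebra.coeff_mapAlgHom]
    rfl

/-- The subalgebra of the elements whose weights are bounded above by a natural number. -/
noncomputable def boundedSubalgebra : Subalgebra ℂ RussellCubicRing where
  carrier := {b | ∃ n : ℕ, ∀ γ, (n : ℝ*) < γ → (laurent b).coeff γ = 0}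
  mul_mem' := by
    rintro a b ⟨m, hm⟩ ⟨n, hn⟩
    refine ⟨m + n, fun γ hγ => ?_⟩
    rw [map_mul]
    exact (IsTopForm.mul ⟨rfl, hm⟩ ⟨rfl, hn⟩).2 γ (by push_cast at hγ; exact hγ)
  add_mem' := by
    rintro a b ⟨m, hm⟩ ⟨n, hn⟩
    refine ⟨m + n, fun γ hγ => ?_⟩
    have h1 : (0 : ℝ*) ≤ m := Nat.cast_nonneg m
    have h2 : (0 : ℝ*) ≤ n := Nat.cast_nonneg n
    push_cast at hγ
    simp [hm γ (by linarith), hn γ (by linarith)]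
  algebraMap_mem' := fun r => ⟨0, fun γ hγ => by
    rw [AlgHom.commutes]
    exact (IsTopForm.single (0 : ℝ*) (algebraMap ℂ CoordField r)).2 γ (by simpa using hγ)⟩

theorem gen_one_notMem_boundedSubalgebra : gen 1 ∉ boundedSubalgebra := by
  rintro ⟨n, hn⟩
  have h1 := (isTopForm_laurent_gen 1).1
  rw [hn] at h1
  · exact topCoord_ne_zero 1 h1.symm
  · change (n : ℝ*) < 6 + 2 * Hyperreal.omega
    have h2 := Hyperreal.natCast_lt_omega n
    have h3 := Hyperreal.omega_pos
    linarith

/-- The top form of an element which is constant along a deformation. -/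
theorem exists_isTopForm_of_fixed
    {Ψ : RussellCubicRing →ₐ[ℂ] AddMonoidAlgebra (Polynomial CoordField) ℝ*}
    {d : Fin 4 → Polynomial CoordField}
    (hd : ∀ i, IsTopForm (Ψ (gen i)) (russellWeight i) (d i))
    {f : RussellCubicRing} (hf0 : f ≠ 0)
    (hf : ∀ γ, (Ψ f).coeff γ = Polynomial.C ((laurent f).coeff γ)) :
    ∃ (a b e : ℕ) (κ : CoordField), (a = 0 ∨ (d 0).natDegree = 0) ∧
      (b = 0 ∨ (d 1).natDegree = 0) ∧
      (e = 0 ∨ (d 2).natDegree = 0 ∨ (d 3).natDegree = 0 ∨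
        ∃ ρ : ℂ, ρ ≠ 0 ∧ d 2 ^ 2 - ρ • d 3 ^ 3 ≠ 0 ∧ (d 2 ^ 2 - ρ • d 3 ^ 3).natDegree = 0) ∧
      IsTopForm (laurent f) (((2 * b - a : ℤ) : ℝ*) * Hyperreal.omega + (6 * b + e : ℕ)) κ ∧
      κ ≠ 0 ∧ (a = 0 → e = 0 → ∃ c : ℂ, κ = c • topCoord 1 ^ b) := by
  obtain ⟨S, c, a, b, e, hS, hκ, h⟩ := exists_isTopForm hf0
  have h1 := h _ laurent _ isTopForm_laurent_gen
  have h2 := (h _ Ψ d hd).1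
  rw [hf, h1.1] at h2
  have h3 := hκ
  rw [← Polynomial.C_ne_zero, h2] at h3
  have h4 := congrArg Polynomial.natDegree h2
  rw [Polynomial.natDegree_C, Polynomial.natDegree_mul (left_ne_zero_of_mul h3)
    (right_ne_zero_of_mul h3), Polynomial.natDegree_mul (left_ne_zero_of_mul
    (left_ne_zero_of_mul h3)) (right_ne_zero_of_mul (left_ne_zero_of_mul h3)),
    Polynomial.natDegree_pow, Polynomial.natDegree_pow] at h4
  refine ⟨a, b, e, _, ?_, ?_, ?_, h1, hκ, ?_⟩
  · exact Nat.mul_eq_zero.1 (by omega)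
  · exact Nat.mul_eq_zero.1 (by omega)
  · refine or_iff_not_imp_left.2 fun he => natDegree_eq_zero_of_weighted_sum he hS
      (right_ne_zero_of_mul h3) (by omega)
  · rintro rfl rfl
    refine ⟨∑ m ∈ S, c m, ?_⟩
    rw [pow_zero, one_mul, Finset.sum_smul, Finset.mul_sum]
    refine Finset.sum_congr rfl fun m hm => ?_
    have h5 := hS m hm
    rw [show m 2 = 0 by omega, show m 3 = 0 by omega]
    simp

theorem relation_of_isTopForm {R : Type} [CommRing R] [Algebra ℂ R]
    {Ψ : RussellCubicRing →ₐ[ℂ] AddMonoidAlgebra R ℝ*} {d : Fin 4 → R}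
    (hd : ∀ i, IsTopForm (Ψ (gen i)) (russellWeight i) (d i)) :
    d 0 ^ 2 * d 1 + d 2 ^ 2 + d 3 ^ 3 = 0 := by
  have h0 := congrArg Ψ gen_relation
  simp only [map_add, map_mul, map_pow, map_zero] at h0
  have h1 : IsTopForm (Ψ (gen 0)) 6 0 := (hd 0).of_lt (by
    change -Hyperreal.omega < 6
    have := Hyperreal.omega_pos
    linarith)
  have h2 : IsTopForm (Ψ (gen 0) ^ 2 * Ψ (gen 1)) 6 (d 0 ^ 2 * d 1) := by
    convert ((hd 0).pow 2).mul (hd 1) using 1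
    change 6 = 2 • -Hyperreal.omega + (6 + 2 * Hyperreal.omega)
    simp
  have h3 : IsTopForm (Ψ (gen 2) ^ 2) 6 (d 2 ^ 2) := by
    convert (hd 2).pow 2 using 1
    change 6 = 2 • (3 : ℝ*)
    norm_num
  have h4 : IsTopForm (Ψ (gen 3) ^ 3) 6 (d 3 ^ 3) := by
    convert (hd 3).pow 3 using 1
    change 6 = 3 • (2 : ℝ*)
    norm_num
  have h5 := ((h1.add h2).add h3).add h4
  rw [h0, zero_add] at h5
  exact h5.unique (IsTopForm.zero _)

/-- If a nontrivial deformation fixes an element of infinite weight, then the top form of every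
fixed element is a scalar multiple of a power of the top form of `y`. -/
theorem exists_isTopForm_smul_pow {φ : RussellCubicRing →ₐ[ℂ] Polynomial RussellCubicRing}
    (h0 : ∀ f, (φ f).coeff 0 = f) (hφ : ∃ f, φ f ≠ Polynomial.C f)
    {u : RussellCubicRing} (hu : φ u = Polynomial.C u) (hub : u ∉ boundedSubalgebra)
    {f : RussellCubicRing} (hf0 : f ≠ 0) (hf : φ f = Polynomial.C f) :
    ∃ (b : ℕ) (c : ℂ), c ≠ 0 ∧
      IsTopForm (laurent f) (b • (6 + 2 * Hyperreal.omega)) (c • topCoord 1 ^ b) := by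
  obtain ⟨Ψ, d, hd, hd0, ⟨i, hi⟩, hfix⟩ := exists_deformation φ h0 hφ
  have hne : ∀ i, d i ≠ 0 := fun i h => topCoord_ne_zero i (by rw [← hd0, h]; simp)
  have hY : (d 1).natDegree = 0 := by
    obtain ⟨a, b, e, κ, -, hb, -, h, -⟩ := exists_isTopForm_of_fixed hd
      (by rintro rfl; exact hub (zero_mem _)) (hfix u hu)
    refine hb.resolve_left ?_
    rintro rfl
    refine hub ⟨e, fun γ hγ => h.2 γ (lt_of_le_of_lt ?_ hγ)⟩
    have h1 := mul_nonneg (Nat.cast_nonneg (α := ℝ*) a) Hyperreal.omega_pos.le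
    push_cast
    linarith
  have key : ¬((d 0).natDegree = 0 ∨ (d 2).natDegree = 0 ∨ (d 3).natDegree = 0 ∨
      ∃ ρ : ℂ, ρ ≠ 0 ∧ d 2 ^ 2 - ρ • d 3 ^ 3 ≠ 0 ∧ (d 2 ^ 2 - ρ • d 3 ^ 3).natDegree = 0) := by
    intro h
    obtain ⟨h1, h2, h3⟩ := natDegree_eq_zero_of_curve (hne 0) (hne 1) (hne 2) (hne 3)
      (relation_of_isTopForm hd) hY h
    fin_cases i
    exacts [hi h1, hi hY, hi h2, hi h3]
  obtain ⟨a, b, e, κ, ha, -, he, h, hκ, hc⟩ := exists_isTopForm_of_fixed hd hf0 (hfix f hf)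
  obtain rfl := ha.resolve_right fun h => key (Or.inl h)
  obtain rfl := he.resolve_right fun h => key (Or.inr h)
  obtain ⟨c, rfl⟩ := hc rfl rfl
  refine ⟨b, c, by rintro rfl; simp at hκ, ?_⟩
  convert h using 1
  push_cast
  rw [nsmul_eq_mul]
  ring

end RussellCubicRing

/-- A filtration with successive quotients of dimension at most one. -/
theorem Submodule.exists_finset_card_le_span {k V : Type*} [Field k] [AddCommGroup V] [Module k V]
    {F : ℕ → Submodule k V} (h0 : F 0 = ⊥) (h : ∀ n, ∃ v, F (n + 1) ≤ F n ⊔ span k {v}) (n : ℕ) :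
    ∃ s : Finset V, s.card ≤ n ∧ F n ≤ span k (s : Set V) := by
  classical
  induction n with
  | zero => exact ⟨∅, by simp, by simp [h0]⟩
  | succ n ih =>
    obtain ⟨s, hs, hF⟩ := ih
    obtain ⟨v, hv⟩ := h n
    refine ⟨insert v s, (Finset.card_insert_le _ _).trans (by omega), hv.trans ?_⟩
    rw [Finset.coe_insert, span_insert, sup_comm]
    gcongr

namespace RussellCubicRing

/-- The elements of a subspace `E` of weight less than `n` times that of `y`. -/
noncomputable def weightFiltration (E : Submodule ℂ RussellCubicRing) (n : ℕ) :
    Submodule ℂ RussellCubicRing where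
  carrier := {f | f ∈ E ∧ ∀ γ, n • (6 + 2 * Hyperreal.omega) ≤ γ → (laurent f).coeff γ = 0}
  add_mem' := fun ha hb => ⟨E.add_mem ha.1 hb.1, fun γ hγ => by simp [ha.2 γ hγ, hb.2 γ hγ]⟩
  zero_mem' := ⟨E.zero_mem, by simp⟩
  smul_mem' := fun c _ ha => ⟨E.smul_mem c ha.1, fun γ hγ => by simp [ha.2 γ hγ]⟩

theorem six_add_two_mul_omega_pos : 0 < 6 + 2 * Hyperreal.omega := by
  have := Hyperreal.omega_pos
  linarith

/-- There is no subalgebra of transcendence degree two all of whose elements have top forms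
proportional to powers of the top form of `y`. -/
theorem not_linearIndependent_of_isTopForm {E : Subalgebra ℂ RussellCubicRing}
    (hE : ∀ f ∈ E, f ≠ 0 → ∃ (b : ℕ) (c : ℂ), c ≠ 0 ∧
      IsTopForm (laurent f) (b • (6 + 2 * Hyperreal.omega)) (c • topCoord 1 ^ b))
    {u v : RussellCubicRing} (hu : u ∈ E) (hv : v ∈ E) :
    ¬ LinearIndependent ℂ fun p : ℕ × ℕ => u ^ p.1 * v ^ p.2 := by
  intro hli
  have hpos := six_add_two_mul_omega_pos
  set F := weightFiltration E.toSubmodule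
  have hb : ∀ {b : ℕ} {c : ℂ} {f : RussellCubicRing} {n : ℕ}, c ≠ 0 →
      IsTopForm (laurent f) (b • (6 + 2 * Hyperreal.omega)) (c • topCoord 1 ^ b) →
      f ∈ F n → b < n := by
    intro b c f n hc hf hfn
    by_contra! h
    have h1 := hfn.2 (b • (6 + 2 * Hyperreal.omega)) (nsmul_le_nsmul_left hpos.le h)
    rw [hf.1] at h1
    exact smul_ne_zero hc (pow_ne_zero _ (topCoord_ne_zero 1)) h1
  have hb' : ∀ {b : ℕ} {f : RussellCubicRing} {n : ℕ} {κ : CoordField}, f ∈ E →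
      IsTopForm (laurent f) (b • (6 + 2 * Hyperreal.omega)) κ → b < n → f ∈ F n :=
    fun hf h hn => ⟨hf, fun γ hγ => h.2 γ (lt_of_lt_of_le (nsmul_lt_nsmul_left hpos hn) hγ)⟩
  have h0 : F 0 = ⊥ := by
    rw [Submodule.eq_bot_iff]
    intro f hf
    by_contra hf0
    obtain ⟨b, c, hc, h⟩ := hE f hf.1 hf0
    exact Nat.not_lt_zero _ (hb hc h hf)
  have hstep : ∀ n, ∃ v, F (n + 1) ≤ F n ⊔ Submodule.span ℂ {v} := by
    intro n
    by_cases hn : F (n + 1) ≤ F n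
    · exact ⟨0, hn.trans le_sup_left⟩
    obtain ⟨f, hf, hfn⟩ := SetLike.not_le_iff_exists.1 hn
    obtain ⟨b, c, hc, h⟩ := hE f hf.1 (by rintro rfl; exact hfn (zero_mem _))
    obtain rfl : b = n := by
      have h1 := hb hc h hf
      have h2 : ¬ b < n := fun h2 => hfn (hb' hf.1 h h2)
      omega
    refine ⟨f, fun g hg => ?_⟩
    by_cases hgb : g ∈ F b
    · exact Submodule.mem_sup_left hgb
    obtain ⟨b', c', hc', h'⟩ := hE g hg.1 (by rintro rfl; exact hgb (zero_mem _))
    obtain rfl : b' = b := by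
      have h1 := hb hc' h' hg
      have h2 : ¬ b' < b := fun h2 => hgb (hb' hg.1 h' h2)
      omega
    rw [← sub_add_cancel g ((c' / c) • f)]
    refine Submodule.add_mem_sup ?_ (Submodule.smul_mem _ _ (Submodule.mem_span_singleton_self f))
    refine ⟨E.toSubmodule.sub_mem hg.1 (E.toSubmodule.smul_mem _ hf.1), fun γ hγ => ?_⟩
    generalize b' • (6 + 2 * Hyperreal.omega) = γ₀ at h h' hγ
    rcases hγ.eq_or_lt with rfl | hγ
    · simp [h.1, h'.1, smul_smul, div_mul_cancel₀ _ hc]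
    · simp [h.2 γ hγ, h'.2 γ hγ]
  obtain ⟨bu, cu, -, hu'⟩ := hE u hu (by
    rintro rfl
    exact hli.ne_zero (1, 0) (by simp))
  obtain ⟨bv, cv, -, hv'⟩ := hE v hv (by
    rintro rfl
    exact hli.ne_zero (0, 1) (by simp))
  set M := bu + bv + 2
  obtain ⟨s, hs, hF⟩ := Submodule.exists_finset_card_le_span h0 hstep (M * (bu + bv) + 1)
  let w : Fin M × Fin M → RussellCubicRing := fun p => u ^ (p.1 : ℕ) * v ^ (p.2 : ℕ)
  have hw : LinearIndependent ℂ w := hli.comp (fun p : Fin M × Fin M => ((p.1 : ℕ), (p.2 : ℕ)))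
    fun p q h => by
      simp only [Prod.mk.injEq] at h
      exact Prod.ext (Fin.ext h.1) (Fin.ext h.2)
  have hws : Set.range w ≤ Submodule.span ℂ (s : Set RussellCubicRing) := by
    rintro _ ⟨⟨i, j⟩, rfl⟩
    refine hF (hb' (b := i * bu + j * bv)
      (κ := (cu • topCoord 1 ^ bu) ^ (i : ℕ) * (cv • topCoord 1 ^ bv) ^ (j : ℕ))
      (E.mul_mem (E.pow_mem hu _) (E.pow_mem hv _)) ?_ ?_)
    · convert (hu'.pow i).mul (hv'.pow j) using 1
      · simp [w]
      · rw [add_smul, mul_smul, mul_smul]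
    · have h1 := Nat.mul_le_mul_right bu i.2.le
      have h2 := Nat.mul_le_mul_right bv j.2.le
      rw [mul_add]
      omega
  have hcard := linearIndependent_le_span' w hw _ hws
  have h1 : M * M ≤ s.card := by
    simp only [Cardinal.mk_fintype, Fintype.card_prod, Fintype.card_fin, Finset.coe_sort_coe,
      Fintype.card_coe] at hcard
    exact_mod_cast hcard
  have h2 : M * M = M * (bu + bv) + 2 * M := by simp only [M]; ring
  omega

/-- The Russell cubic ring is not a polynomial ring. -/
theorem isEmpty_algEquiv : IsEmpty (MvPolynomial (Fin 3) ℂ ≃ₐ[ℂ] RussellCubicRing) := by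
  refine ⟨fun e => ?_⟩
  obtain ⟨k, hk⟩ : ∃ k, e (X k) ∉ boundedSubalgebra := by
    by_contra! h
    have h1 : (⊤ : Subalgebra ℂ (MvPolynomial (Fin 3) ℂ)) ≤
        boundedSubalgebra.comap (e : MvPolynomial (Fin 3) ℂ →ₐ[ℂ] RussellCubicRing) := by
      rw [← adjoin_range_X]
      refine Algebra.adjoin_le ?_
      rintro _ ⟨i, rfl⟩
      exact h i
    have h2 := h1 (Algebra.mem_top (x := e.symm (gen 1)))
    exact gen_one_notMem_boundedSubalgebra (by simpa using h2)
  let v : Fin 3 → Polynomial RussellCubicRing := fun j =>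
    Polynomial.C (e (X j)) + if j = k + 1 then Polynomial.X else 0
  let φ : RussellCubicRing →ₐ[ℂ] Polynomial RussellCubicRing := (aeval v).comp e.symm
  have hφ : ∀ j, φ (e (X j)) = v j := by simp [φ]
  have hcoeff : ∀ f, (φ f).coeff 0 = f := by
    intro f
    obtain ⟨p, rfl⟩ := e.surjective f
    simp only [φ, AlgHom.comp_apply, AlgEquiv.coe_toAlgHom, AlgEquiv.symm_apply_apply]
    induction p using MvPolynomial.induction_on with
    | C a =>
      rw [← algebraMap_eq, AlgHom.commutes, AlgEquiv.commutes]
      simp [Polynomial.algebraMap_apply]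
    | add p q hp hq => simp [hp, hq]
    | mul_X p j hp =>
      rw [map_mul, map_mul, Polynomial.mul_coeff_zero, hp, aeval_X]
      congr 1
      simp only [v]
      split_ifs <;> simp
  have hfix : ∀ j, j ≠ k + 1 → φ (e (X j)) = Polynomial.C (e (X j)) := by
    intro j hj
    simp [hφ, v, hj]
  have hk1 : k ≠ k + 1 := (by decide : ∀ k : Fin 3, k ≠ k + 1) k
  have hk2 : k + 2 ≠ k + 1 := (by decide : ∀ k : Fin 3, k + 2 ≠ k + 1) k
  have hk3 : k ≠ k + 2 := (by decide : ∀ k : Fin 3, k ≠ k + 2) k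
  have hne : ∃ f, φ f ≠ Polynomial.C f := ⟨e (X (k + 1)), by simp [hφ, v]⟩
  refine not_linearIndependent_of_isTopForm (E := AlgHom.equalizer φ Polynomial.CAlgHom)
    (fun f hf hf0 => exists_isTopForm_smul_pow hcoeff hne (hfix k hk1) hk hf0 hf)
    (u := e (X k)) (v := e (X (k + 2))) (hfix k hk1) (hfix _ hk2) ?_
  have h1 := (basisMonomials (Fin 3) ℂ).linearIndependent.map' e.toLinearMap
    (LinearMap.ker_eq_bot.2 e.injective)
  have h2 := h1.comp (fun p : ℕ × ℕ => Finsupp.single k p.1 + Finsupp.single (k + 2) p.2) ?_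
  · have h3 : (e.toLinearMap ∘ basisMonomials (Fin 3) ℂ) ∘
        (fun p : ℕ × ℕ => Finsupp.single k p.1 + Finsupp.single (k + 2) p.2) =
        fun p => e (X k) ^ p.1 * e (X (k + 2)) ^ p.2 := by
      ext p
      simp [X_pow_eq_monomial, monomial_mul, ← map_pow, ← map_mul]
    rwa [h3] at h2
  · intro p q h
    have h3 := DFunLike.congr_fun h k
    have h4 := DFunLike.congr_fun h (k + 2)
    simp [hk3, hk3.symm] at h3 h4
    exact Prod.ext h3 h4

end RussellCubicRing

section PositiveGrading

variable {k A : Type*} [Field k] [CommRing A] [Algebra k A]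

/-- The span of the homogeneous elements of positive degree. -/
def positivePart (𝒜 : ℤ → Submodule k A) : Submodule k A :=
  Submodule.span k {a | ∃ i, 0 < i ∧ a ∈ 𝒜 i}

theorem positivePart_mul_le (𝒜 : ℤ → Submodule k A) [SetLike.GradedMonoid 𝒜] :
    positivePart 𝒜 * positivePart 𝒜 ≤ positivePart 𝒜 := by
  rw [positivePart, Submodule.span_mul_span]
  refine Submodule.span_mono ?_
  rintro _ ⟨a, ⟨i, hi, ha⟩, b, ⟨j, hj, hb⟩, rfl⟩
  exact ⟨i + j, add_pos hi hj, SetLike.mul_mem_graded ha hb⟩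

variable {𝒜 : ℤ → Submodule k A} [GradedAlgebra 𝒜]

theorem proj_zero_of_mem_positivePart {a : A} (ha : a ∈ positivePart 𝒜) :
    GradedAlgebra.proj 𝒜 0 a = 0 := by
  rw [positivePart] at ha
  induction ha using Submodule.span_induction with
  | mem a ha =>
    obtain ⟨i, hi, ha⟩ := ha
    rw [GradedAlgebra.proj_apply, DirectSum.decompose_of_mem_ne 𝒜 ha hi.ne']
  | zero => simp
  | add a b _ _ ha hb => rw [map_add, ha, hb, add_zero]
  | smul c a _ ha => rw [map_smul, ha, smul_zero]

theorem eq_zero_of_algebraMap_mem_positivePart [Nontrivial A] {c : k}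
    (hc : algebraMap k A c ∈ positivePart 𝒜) : c = 0 := by
  have h := proj_zero_of_mem_positivePart hc
  rwa [GradedAlgebra.proj_apply, DirectSum.decompose_of_mem_same 𝒜
    (SetLike.algebraMap_mem_graded 𝒜 c), map_eq_zero_iff _ (algebraMap k A).injective] at h

theorem exists_sub_algebraMap_mem_positivePart (hneg : ∀ i < 0, 𝒜 i = ⊥) (h0 : 𝒜 0 = 1) (a : A) :
    ∃ c : k, a - algebraMap k A c ∈ positivePart 𝒜 := by
  induction a using DirectSum.Decomposition.inductionOn 𝒜 with
  | zero => exact ⟨0, by simp⟩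
  | @homogeneous i a =>
    obtain ⟨a, ha⟩ := a
    rcases lt_trichotomy i 0 with hi | rfl | hi
    · rw [hneg i hi, Submodule.mem_bot] at ha
      exact ⟨0, by simp [ha]⟩
    · rw [h0, Submodule.mem_one] at ha
      obtain ⟨c, rfl⟩ := ha
      exact ⟨c, by simp⟩
    · refine ⟨0, ?_⟩
      rw [map_zero, sub_zero]
      exact Submodule.subset_span ⟨i, hi, ha⟩
  | add a b ha hb =>
    obtain ⟨c, hc⟩ := ha
    obtain ⟨d, hd⟩ := hb
    exact ⟨c + d, by rw [map_add, add_sub_add_comm]; exact Submodule.add_mem _ hc hd⟩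

/-- Graded Nakayama: homogeneous elements of positive degree which span the positive part modulo
its square generate the algebra. -/
theorem adjoin_eq_top_of_positivePart_le (hneg : ∀ i < 0, 𝒜 i = ⊥) (h0 : 𝒜 0 = 1) {s : Set A}
    (hs : ∀ a ∈ s, ∃ i, 0 < i ∧ a ∈ 𝒜 i)
    (h : positivePart 𝒜 ≤ Submodule.span k s ⊔ positivePart 𝒜 * positivePart 𝒜) :
    Algebra.adjoin k s = ⊤ := by
  set S := Algebra.adjoin k s
  have key : ∀ n : ℕ, ∀ i : ℤ, i < n → 𝒜 i ≤ S.toSubmodule := by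
    intro n
    induction n with
    | zero =>
      intro i hi
      rw [hneg i (by simpa using hi)]
      exact bot_le
    | succ n ih =>
      intro i hi
      rcases eq_or_ne i 0 with rfl | hi0
      · rw [h0]
        exact Submodule.one_le.2 S.one_mem
      rcases lt_or_ge i n with hin | hin
      · exact ih i hin
      obtain rfl : i = n := by push_cast at hi; omega
      have hspan : Submodule.span k s ≤ S.toSubmodule.comap (GradedAlgebra.proj 𝒜 n) := by
        rw [Submodule.span_le]
        intro a ha
        obtain ⟨j, hj, haj⟩ := hs a ha
        rw [SetLike.mem_coe, Submodule.mem_comap, GradedAlgebra.proj_apply]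
        rcases eq_or_ne j n with rfl | hjn
        · rw [DirectSum.decompose_of_mem_same 𝒜 haj]
          exact Algebra.subset_adjoin ha
        · rw [DirectSum.decompose_of_mem_ne 𝒜 haj hjn]
          exact zero_mem _
      have hmul : positivePart 𝒜 * positivePart 𝒜 ≤
          S.toSubmodule.comap (GradedAlgebra.proj 𝒜 n) := by
        rw [positivePart, Submodule.span_mul_span, Submodule.span_le]
        rintro _ ⟨a, ⟨p, hp, ha⟩, b, ⟨q, hq, hb⟩, rfl⟩
        rw [SetLike.mem_coe, Submodule.mem_comap, GradedAlgebra.proj_apply]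
        have hab : a * b ∈ 𝒜 (p + q) := SetLike.mul_mem_graded ha hb
        rcases eq_or_ne (p + q) n with hpq | hpq
        · rw [← hpq, DirectSum.decompose_of_mem_same 𝒜 hab]
          exact S.mul_mem (ih p (by omega) ha) (ih q (by omega) hb)
        · rw [DirectSum.decompose_of_mem_ne 𝒜 hab hpq]
          exact zero_mem _
      intro a ha
      have h1 := (h.trans (sup_le hspan hmul)) (Submodule.subset_span ⟨(n : ℤ), by omega, ha⟩)
      rwa [Submodule.mem_comap, GradedAlgebra.proj_apply,
        DirectSum.decompose_of_mem_same 𝒜 ha] at h1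
  rw [eq_top_iff]
  intro a _
  induction a using DirectSum.Decomposition.inductionOn 𝒜 with
  | zero => exact zero_mem _
  | @homogeneous i a => exact key (i.toNat + 1) i (by omega) a.2
  | add a b ha hb => exact add_mem (ha trivial) (hb trivial)

/-- If `x` generates the algebra and consists of elements of the positive part, then `x` spans the
positive part modulo its square. -/
theorem positivePart_le_span_sup_mul [Nontrivial A] {s : Set A} (hs : s ⊆ positivePart 𝒜)
    (hadj : Algebra.adjoin k s = ⊤) :
    positivePart 𝒜 ≤ Submodule.span k s ⊔ positivePart 𝒜 * positivePart 𝒜 := by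
  set m := positivePart 𝒜
  have hle : Submodule.span k s ⊔ m * m ≤ m :=
    sup_le (Submodule.span_le.2 hs) (positivePart_mul_le 𝒜)
  have key : ∀ a : A, ∃ c : k, a - algebraMap k A c ∈ Submodule.span k s ⊔ m * m := by
    intro a
    have ha : a ∈ Algebra.adjoin k s := hadj ▸ Algebra.mem_top
    induction ha using Algebra.adjoin_induction with
    | mem a ha => exact ⟨0, by simpa using Submodule.mem_sup_left (Submodule.subset_span ha)⟩
    | algebraMap c => exact ⟨c, by simp⟩
    | add a b _ _ ha hb =>
      obtain ⟨c, hc⟩ := ha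
      obtain ⟨d, hd⟩ := hb
      exact ⟨c + d, by rw [map_add, add_sub_add_comm]; exact Submodule.add_mem _ hc hd⟩
    | mul a b _ _ ha hb =>
      obtain ⟨c, hc⟩ := ha
      obtain ⟨d, hd⟩ := hb
      refine ⟨c * d, ?_⟩
      have h : a * b - algebraMap k A (c * d) = (a - algebraMap k A c) * (b - algebraMap k A d) +
          c • (b - algebraMap k A d) + d • (a - algebraMap k A c) := by
        rw [Algebra.smul_def, Algebra.smul_def, map_mul]
        ring
      rw [h]
      exact add_mem (add_mem (Submodule.mem_sup_right (Submodule.mul_mem_mul (hle hc) (hle hd)))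
        (Submodule.smul_mem _ _ hd)) (Submodule.smul_mem _ _ hc)
  intro a ha
  obtain ⟨c, hc⟩ := key a
  have h1 : algebraMap k A c ∈ m := by
    have := m.sub_mem ha (hle hc)
    rwa [sub_sub_cancel] at this
  rw [eq_zero_of_algebraMap_mem_positivePart h1] at hc
  simpa using hc

theorem exists_fin_adjoin_eq_top (hneg : ∀ i < 0, 𝒜 i = ⊥) (h0 : 𝒜 0 = 1) {n : ℕ} {y : Fin n → A}
    (hy : positivePart 𝒜 ≤ Submodule.span k (Set.range y) ⊔ positivePart 𝒜 * positivePart 𝒜) :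
    ∃ r ≤ n, ∃ v : Fin r → A, Algebra.adjoin k (Set.range v) = ⊤ := by
  set q := (positivePart 𝒜 * positivePart 𝒜).mkQ with hq
  have hmap : Submodule.span k (q '' {a | ∃ i, 0 < i ∧ a ∈ 𝒜 i}) ≤
      Submodule.span k (Set.range (q ∘ y)) := by
    rw [← Submodule.map_span, Set.range_comp, ← Submodule.map_span]
    refine (Submodule.map_mono hy).trans ?_
    rw [Submodule.map_sup, hq, Submodule.mkQ_map_self, sup_bot_eq]
  have : FiniteDimensional k (Submodule.span k (Set.range (q ∘ y))) :=
    FiniteDimensional.span_of_finite k (Set.finite_range _)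
  have : FiniteDimensional k (Submodule.span k (q '' {a | ∃ i, 0 < i ∧ a ∈ 𝒜 i})) :=
    Submodule.finiteDimensional_of_le hmap
  obtain ⟨f, hf, hspan, -⟩ :=
    Submodule.exists_fun_fin_finrank_span_eq k (q '' {a | ∃ i, 0 < i ∧ a ∈ 𝒜 i})
  choose v hv hvf using hf
  refine ⟨_, ?_, v, adjoin_eq_top_of_positivePart_le hneg h0 (by rintro _ ⟨i, rfl⟩; exact hv i) ?_⟩
  · have h1 := finrank_range_le_card (R := k) (q ∘ y)
    rw [Fintype.card_fin] at h1
    exact (Submodule.finrank_mono hmap).trans h1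
  · rw [sup_comm, ← Submodule.comap_map_mkQ, ← Submodule.map_le_iff_le_comap, ← hq,
      Submodule.map_span, ← Set.range_comp]
    refine (Submodule.map_span q _).trans_le (hspan.ge.trans ?_)
    exact Submodule.span_mono (by rw [show q ∘ v = f from funext hvf])

end PositiveGrading

namespace RussellCubicRing

theorem three_le_trdeg : 3 ≤ Algebra.trdeg ℂ RussellCubicRing := by
  have h : AlgebraicIndependent ℂ (gen ∘ ![0, 2, 3]) := by
    rw [algebraicIndependent_iff]
    intro p hp
    by_contra hp0
    have hinj : Function.Injective (![0, 2, 3] : Fin 3 → Fin 4) := by decide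
    refine aeval_gen_ne_zero (P := rename ![0, 2, 3] p) ?_ ?_ ?_
    · rwa [Ne, map_eq_zero_iff _ (rename_injective _ hinj)]
    · intro m hm
      right
      rw [support_rename_of_injective hinj, Finset.mem_image] at hm
      obtain ⟨m, -, rfl⟩ := hm
      exact Finsupp.mapDomain_of_notMem_range _ _ (by decide)
    · rwa [aeval_rename]
  simpa using h.cardinalMk_le_trdeg

/-- The Taylor expansion of `x + x²y + z² + t³` at the point `c`. -/
theorem taylor_relation {k A : Type*} [CommRing k] [CommRing A] [Algebra k A] (c : Fin 4 → k)
    (b : Fin 4 → A) :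
    let x := fun i => b i - algebraMap k A (c i)
    b 0 + b 0 ^ 2 * b 1 + b 2 ^ 2 + b 3 ^ 3 =
      algebraMap k A (c 0 + c 0 ^ 2 * c 1 + c 2 ^ 2 + c 3 ^ 3) +
        (∑ i, ![1 + 2 * c 0 * c 1, c 0 ^ 2, 2 * c 2, 3 * c 3 ^ 2] i • x i +
          ((2 * c 0) • (x 0 * x 1) + c 1 • (x 0 * x 0) + (x 0 * x 0) * x 1 + x 2 * x 2 +
            (3 * c 3) • (x 3 * x 3) + (x 3 * x 3) * x 3)) := by
  simp only [Fin.sum_univ_four, Algebra.smul_def, map_add, map_mul, map_pow, map_one, map_ofNat,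
    Matrix.cons_val]
  ring

/-- A positive grading forces the Russell cubic ring to be a polynomial ring. -/
theorem nonempty_algEquiv_of_hasPositiveZGrading (h : HasPositiveZGrading ℂ RussellCubicRing) :
    Nonempty (MvPolynomial (Fin 3) ℂ ≃ₐ[ℂ] RussellCubicRing) := by
  obtain ⟨𝒜, ⟨_⟩, hneg, h0⟩ := h
  choose c hc using fun i => exists_sub_algebraMap_mem_positivePart hneg h0 (gen i)
  set m := positivePart 𝒜 with hm
  set x : Fin 4 → RussellCubicRing := fun i => gen i - algebraMap ℂ _ (c i) with hx
  have hspan : m ≤ Submodule.span ℂ (Set.range x) ⊔ m * m := by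
    refine positivePart_le_span_sup_mul (by rintro _ ⟨i, rfl⟩; exact hc i) ?_
    rw [eq_top_iff, ← adjoin_range_gen]
    refine Algebra.adjoin_le ?_
    rintro _ ⟨i, rfl⟩
    rw [← sub_add_cancel (gen i) (algebraMap ℂ _ (c i))]
    exact add_mem (Algebra.subset_adjoin ⟨i, rfl⟩) (Subalgebra.algebraMap_mem _ _)
  let g : Fin 4 → ℂ := ![1 + 2 * c 0 * c 1, c 0 ^ 2, 2 * c 2, 3 * c 3 ^ 2]
  obtain ⟨j, hj⟩ : ∃ j, g j ≠ 0 := by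
    by_contra! h
    have h1 : c 0 ^ 2 = 0 := h 1
    have h2 : 1 + 2 * c 0 * c 1 = 0 := h 0
    rw [pow_eq_zero_iff two_ne_zero] at h1
    simp [h1] at h2
  have hmm : ∀ {a b}, a ∈ m → b ∈ m → a * b ∈ m * m := fun ha hb => Submodule.mul_mem_mul ha hb
  have hle : m * m ≤ m := positivePart_mul_le 𝒜
  have hgrad : ∑ i, g i • x i ∈ m * m := by
    set Q := (2 * c 0) • (x 0 * x 1) + c 1 • (x 0 * x 0) + (x 0 * x 0) * x 1 + x 2 * x 2 +
      (3 * c 3) • (x 3 * x 3) + (x 3 * x 3) * x 3 with hQ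
    have hQm : Q ∈ m * m := by
      refine add_mem (add_mem (add_mem (add_mem (add_mem ?_ ?_) ?_) ?_) ?_) ?_
      · exact Submodule.smul_mem _ _ (hmm (hc 0) (hc 1))
      · exact Submodule.smul_mem _ _ (hmm (hc 0) (hc 0))
      · exact hmm (hle (hmm (hc 0) (hc 0))) (hc 1)
      · exact hmm (hc 2) (hc 2)
      · exact Submodule.smul_mem _ _ (hmm (hc 3) (hc 3))
      · exact hmm (hle (hmm (hc 3) (hc 3))) (hc 3)
    have hrel : algebraMap ℂ RussellCubicRing (c 0 + c 0 ^ 2 * c 1 + c 2 ^ 2 + c 3 ^ 3) +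
        (∑ i, g i • x i + Q) = 0 := by
      rw [← gen_relation, hQ]
      exact (taylor_relation c gen).symm
    have hsum : ∑ i, g i • x i + Q ∈ m :=
      add_mem (Submodule.sum_mem _ fun i _ => Submodule.smul_mem _ _ (hc i)) (hle hQm)
    have hconst := eq_neg_of_add_eq_zero_left hrel
    have h1 := eq_zero_of_algebraMap_mem_positivePart (hconst ▸ m.neg_mem hsum)
    rw [h1, map_zero, zero_add] at hrel
    rw [eq_neg_of_add_eq_zero_left hrel]
    exact Submodule.neg_mem _ hQm
  have hspan' : m ≤ Submodule.span ℂ (Set.range (x ∘ j.succAbove)) ⊔ m * m := by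
    refine hspan.trans (sup_le (Submodule.span_le.2 ?_) le_sup_right)
    have hi : ∀ i, x (j.succAbove i) ∈
        Submodule.span ℂ (Set.range (x ∘ j.succAbove)) ⊔ m * m := fun i =>
      Submodule.mem_sup_left (Submodule.subset_span ⟨i, rfl⟩)
    rintro _ ⟨i, rfl⟩
    induction i using Fin.succAboveCases j with
    | x =>
      rw [Fin.sum_univ_succAbove _ j] at hgrad
      have h1 := Submodule.sub_mem _ (Submodule.mem_sup_right hgrad)
        (Submodule.sum_mem _ fun i (_ : i ∈ Finset.univ) =>
          Submodule.smul_mem _ (g (j.succAbove i)) (hi i))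
      rw [add_sub_cancel_right] at h1
      exact (Submodule.smul_mem_iff _ hj).1 h1
    | p i => exact hi i
  obtain ⟨r, hr, v, hv⟩ := exists_fin_adjoin_eq_top hneg h0 hspan'
  have halg : Algebra.IsAlgebraic (Algebra.adjoin ℂ (Set.range v)) RussellCubicRing :=
    ⟨fun a => isAlgebraic_algebraMap (⟨a, hv ▸ Algebra.mem_top⟩ : Algebra.adjoin ℂ (Set.range v))⟩
  have h3 : 3 ≤ r := by
    have h1 := three_le_trdeg.trans
      ((Algebra.IsAlgebraic.trdeg_le_cardinalMk ℂ (Set.range v)).trans Cardinal.mk_range_le)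
    rw [Cardinal.mk_fin] at h1
    exact_mod_cast h1
  obtain rfl : r = 3 := le_antisymm hr h3
  have hind : AlgebraicIndependent ℂ v :=
    (Algebra.IsAlgebraic.isTranscendenceBasis_of_le_trdeg_of_finite ℂ v
      (by simpa using three_le_trdeg)).1
  refine ⟨AlgEquiv.ofBijective (aeval v) ⟨hind, ?_⟩⟩
  rw [← AlgHom.range_eq_top, ← Algebra.adjoin_range_eq_range_aeval, hv]

end RussellCubicRing

/-- Let `B = ℂ[x, y, z, t]/(x + x²y + z² + t³)` be the coordinate ring of
the Russell cubic threefold.  Then `B` admits no positive ℤ-grading over ℂ: there is no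
ℤ-grading `B = ⊕_{i∈ℤ} B_i` with `B_i = 0` for all `i < 0` and `B_0 = ℂ`. -/
theorem stmt_18 : ¬ HasPositiveZGrading ℂ RussellCubicRing := fun h =>
  RussellCubicRing.isEmpty_algEquiv.false
    (RussellCubicRing.nonempty_algEquiv_of_hasPositiveZGrading h).some
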